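/- For f ∈ bmo(ℝⁿ), the following are equivalent: (1) f ∈ cmo(ℝⁿ), i.e., there exist continuous functions g_j with compact support in ℝⁿ such that ‖f − g_j‖_{bmo(ℝⁿ)} → 0; (3) lim_{t→0⁺} ω(f,t) = 0, lim_{|x|→∞} sup{ ⨍_Q |f − f_Q| : Q a cube centered at x with ℓ(Q) ≤ 1 } = 0, and lim_{|x|→∞} |f|_{Q_0 + x} = 0, where Q_0 = [0,1]ⁿ. -/

import Mathlib

open MeasureTheory Metric Filter Topology

noncomputable section

/-- A closed axis-parallel cube in ℝⁿ: a closed ball in the sup norm with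
positive radius (`half` = half the sidelength). -/
structure Cube (n : ℕ) where
  center : Fin n → ℝ
  half : ℝ
  half_pos : 0 < half

namespace Cube

variable {n : ℕ}

/-- The underlying set of a cube. -/
def toSet (Q : Cube n) : Set (Fin n → ℝ) := Metric.closedBall Q.center Q.half

/-- The sidelength ℓ(Q). -/
def side (Q : Cube n) : ℝ := 2 * Q.half

/-- The mean f_Q of f over Q. -/
def avg (Q : Cube n) (f : (Fin n → ℝ) → ℝ) : ℝ := ⨍ x in Q.toSet, f x

/-- Mean oscillation of f over Q. -/
def osc (Q : Cube n) (f : (Fin n → ℝ) → ℝ) : ℝ := ⨍ x in Q.toSet, |f x - Q.avg f|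

/-- The mean |f|_Q of |f| over Q. -/
def avgAbs (Q : Cube n) (f : (Fin n → ℝ) → ℝ) : ℝ := ⨍ x in Q.toSet, |f x|

/-- Distance from the cube to the origin. -/
def distToOrigin (Q : Cube n) : ℝ := Metric.infDist (0 : Fin n → ℝ) Q.toSet

/-- The cube 2Q, concentric with Q and of twice the sidelength. -/
def double (Q : Cube n) : Cube n := ⟨Q.center, 2 * Q.half, mul_pos two_pos Q.half_pos⟩

end Cube

variable {n : ℕ}

/-- The modulus of mean oscillation ω_U(f,t): the supremum of the mean oscillation
of f over cubes Q ⊆ U of sidelength < t. -/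
def omegaOn (U : Set (Fin n → ℝ)) (f : (Fin n → ℝ) → ℝ) (t : ℝ) : ℝ :=
  sSup {r | ∃ Q : Cube n, Q.toSet ⊆ U ∧ Q.side < t ∧ r = Q.osc f}

/-- sup{ |f|_Q : Q ⊆ U, ℓ(Q) ≥ lam }. -/
def bigAvgSup (U : Set (Fin n → ℝ)) (lam : ℝ) (f : (Fin n → ℝ) → ℝ) : ℝ :=
  sSup {r | ∃ Q : Cube n, Q.toSet ⊆ U ∧ lam ≤ Q.side ∧ r = Q.avgAbs f}

/-- The nonhomogeneous norm ‖f‖_{bmo_lam(U)}. -/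
def bmoNorm (U : Set (Fin n → ℝ)) (lam : ℝ) (f : (Fin n → ℝ) → ℝ) : ℝ :=
  omegaOn U f lam + bigAvgSup U lam f

/-- Membership in bmo_lam(U): integrable on every cube in U and finite norm. -/
def MemBmo (U : Set (Fin n → ℝ)) (lam : ℝ) (f : (Fin n → ℝ) → ℝ) : Prop :=
  (∀ Q : Cube n, Q.toSet ⊆ U → IntegrableOn f Q.toSet) ∧
  BddAbove {r | ∃ Q : Cube n, Q.toSet ⊆ U ∧ Q.side < lam ∧ r = Q.osc f} ∧
  BddAbove {r | ∃ Q : Cube n, Q.toSet ⊆ U ∧ lam ≤ Q.side ∧ r = Q.avgAbs f}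

/-- Sarason's vanishing mean oscillation condition: ω_U(f,t) → 0 as t → 0⁺. -/
def VanishSmallOsc (U : Set (Fin n → ℝ)) (f : (Fin n → ℝ) → ℝ) : Prop :=
  Tendsto (fun t => omegaOn U f t) (nhdsWithin 0 (Set.Ioi 0)) (nhds 0)

/-- f is bounded on U. -/
def BoundedOn (U : Set (Fin n → ℝ)) (f : (Fin n → ℝ) → ℝ) : Prop :=
  ∃ M : ℝ, ∀ x ∈ U, |f x| ≤ M

/-- f is Lipschitz on U. -/
def LipschitzOn (U : Set (Fin n → ℝ)) (f : (Fin n → ℝ) → ℝ) : Prop :=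
  ∃ K : NNReal, LipschitzOnWith K f U

/-- dist(supp f, ∂U) > 0. -/
def SuppAway (U : Set (Fin n → ℝ)) (f : (Fin n → ℝ) → ℝ) : Prop :=
  ∃ d > 0, ∀ x ∈ Function.support f, ∀ y ∈ frontier U, d ≤ dist x y

/-- The nonhomogeneous Lipschitz norm ‖f‖_{Lip_b(U)} = ‖f‖_∞ + Lipschitz seminorm. -/
def lipbNorm (U : Set (Fin n → ℝ)) (f : (Fin n → ℝ) → ℝ) : ℝ :=
  sSup {r | ∃ x ∈ U, r = |f x|} +
  sSup {r | ∃ x ∈ U, ∃ y ∈ U, x ≠ y ∧ r = |f x - f y| / dist x y}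

/-- U is a domain: a nonempty open connected subset of ℝⁿ. -/
def IsRealDomain (U : Set (Fin n → ℝ)) : Prop := IsOpen U ∧ IsConnected U

/-- U is an (ε,δ)-domain. -/
def IsEpsDeltaDomain (U : Set (Fin n → ℝ)) (ε δ : ℝ) : Prop :=
  ∀ x ∈ U, ∀ y ∈ U, dist x y < δ →
    ∃ γ : ℝ → (Fin n → ℝ), ContinuousOn γ (Set.Icc 0 1) ∧ γ 0 = x ∧ γ 1 = y ∧
      (∀ t ∈ Set.Icc (0:ℝ) 1, γ t ∈ U) ∧
      eVariationOn γ (Set.Icc 0 1) ≤ ENNReal.ofReal (ε⁻¹ * dist x y) ∧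
      ∀ t ∈ Set.Icc (0:ℝ) 1,
        ε * (dist (γ t) x * dist (γ t) y) / dist x y ≤ Metric.infDist (γ t) (frontier U)

/-- The natural scale λ_{ε,δ} for an (ε,δ)-domain. -/
def lamED (n : ℕ) (ε δ : ℝ) : ℝ := ε ^ 2 * δ / (320 * n * (1 + Real.sqrt n * ε))

/-- d_Ω(x) = dist(x,∂Ω). -/
def distBd (U : Set (Fin n → ℝ)) (x : Fin n → ℝ) : ℝ := Metric.infDist x (frontier U)

/-- Ω̊_t = {x ∈ Ω : d_Ω(x) ≥ t}. -/
def innerPart (U : Set (Fin n → ℝ)) (t : ℝ) : Set (Fin n → ℝ) :=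
  {x ∈ U | t ≤ distBd U x}

/-- f vanishes at infinity in the bmo_lam(U) sense. -/
def VanishAtInfinity (U : Set (Fin n → ℝ)) (lam : ℝ) (f : (Fin n → ℝ) → ℝ) : Prop :=
  Tendsto (fun R => bmoNorm (U \ Metric.closedBall 0 R) lam f) atTop (nhds 0)

/-- f vanishes at the boundary in the bmo_lam(U) sense. -/
def VanishAtBoundary (U : Set (Fin n → ℝ)) (lam : ℝ) (f : (Fin n → ℝ) → ℝ) : Prop :=
  Tendsto (fun t => bmoNorm (U \ innerPart U t) lam f) (nhdsWithin 0 (Set.Ioi 0)) (nhds 0)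

/-- f is in the bmo_lam(U)-closure of the continuous functions with compact support in U. -/
def InCmoClosure (U : Set (Fin n → ℝ)) (lam : ℝ) (f : (Fin n → ℝ) → ℝ) : Prop :=
  ∃ g : ℕ → (Fin n → ℝ) → ℝ,
    (∀ j, Continuous (g j) ∧ HasCompactSupport (g j) ∧ tsupport (g j) ⊆ U) ∧
    Tendsto (fun j => bmoNorm U lam (f - g j)) atTop (nhds 0)

/-- The homogeneous BMO(ℝⁿ) seminorm: sup of mean oscillation over all cubes. -/
def bmoHNorm (f : (Fin n → ℝ) → ℝ) : ℝ := sSup {r | ∃ Q : Cube n, r = Q.osc f}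

namespace Cube

theorem measurableSet_toSet (Q : Cube n) : MeasurableSet Q.toSet :=
  measurableSet_closedBall

theorem side_pos (Q : Cube n) : 0 < Q.side := mul_pos two_pos Q.half_pos

theorem volume_real_toSet (Q : Cube n) : volume.real Q.toSet = Q.side ^ n := by
  rw [Measure.real, toSet, Real.volume_pi_closedBall _ Q.half_pos.le, Fintype.card_fin,
    ENNReal.toReal_ofReal (by have := Q.half_pos; positivity)]
  rfl

theorem volume_ne_top (Q : Cube n) : volume Q.toSet ≠ ⊤ :=
  measure_closedBall_lt_top.ne

theorem avg_eq (Q : Cube n) (f : (Fin n → ℝ) → ℝ) :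
    Q.avg f = (Q.side ^ n)⁻¹ * ∫ x in Q.toSet, f x := by
  rw [avg, setAverage_eq, volume_real_toSet, smul_eq_mul]

theorem integral_eq_side_pow_mul_avg (Q : Cube n) (f : (Fin n → ℝ) → ℝ) :
    ∫ x in Q.toSet, f x = Q.side ^ n * Q.avg f := by
  have := Q.side_pos
  rw [avg_eq]
  field_simp

theorem avg_const (Q : Cube n) (a : ℝ) : Q.avg (fun _ => a) = a := by
  have := Q.side_pos
  rw [avg_eq, setIntegral_const, volume_real_toSet, smul_eq_mul]
  field_simp

theorem avg_mono {Q : Cube n} {f g : (Fin n → ℝ) → ℝ} (hf : IntegrableOn f Q.toSet)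
    (hg : IntegrableOn g Q.toSet) (h : ∀ x ∈ Q.toSet, f x ≤ g x) : Q.avg f ≤ Q.avg g := by
  have := Q.side_pos
  rw [avg_eq, avg_eq]
  exact mul_le_mul_of_nonneg_left (setIntegral_mono_on hf hg Q.measurableSet_toSet h)
    (by positivity)

theorem avg_nonneg (Q : Cube n) {f : (Fin n → ℝ) → ℝ} (h : ∀ x, 0 ≤ f x) : 0 ≤ Q.avg f := by
  have := Q.side_pos
  rw [avg_eq]
  exact mul_nonneg (by positivity) (integral_nonneg h)

theorem avg_add {Q : Cube n} {f g : (Fin n → ℝ) → ℝ} (hf : IntegrableOn f Q.toSet)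
    (hg : IntegrableOn g Q.toSet) : Q.avg (fun x => f x + g x) = Q.avg f + Q.avg g := by
  rw [avg_eq, avg_eq, avg_eq, integral_add hf hg, mul_add]

theorem integrableOn_const (Q : Cube n) (a : ℝ) :
    IntegrableOn (fun _ : Fin n → ℝ => a) Q.toSet :=
  MeasureTheory.integrableOn_const Q.volume_ne_top

theorem integrableOn_abs_sub_const {Q : Cube n} {f : (Fin n → ℝ) → ℝ}
    (hf : IntegrableOn f Q.toSet) (a : ℝ) : IntegrableOn (fun x => |f x - a|) Q.toSet :=
  (hf.sub (Q.integrableOn_const a)).abs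

theorem avg_sub_const {Q : Cube n} {f : (Fin n → ℝ) → ℝ} (hf : IntegrableOn f Q.toSet) (a : ℝ) :
    Q.avg (fun x => f x - a) = Q.avg f - a := by
  simpa [sub_eq_add_neg, Q.avg_const] using avg_add hf (Q.integrableOn_const (-a))

theorem abs_avg_le (Q : Cube n) (f : (Fin n → ℝ) → ℝ) : |Q.avg f| ≤ Q.avgAbs f := by
  have := Q.side_pos
  change _ ≤ Q.avg (fun x => |f x|)
  rw [avg_eq, avg_eq, abs_mul, abs_of_pos (by positivity : 0 < (Q.side ^ n)⁻¹)]
  exact mul_le_mul_of_nonneg_left abs_integral_le_integral_abs (by positivity)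

theorem abs_avg_sub_le {Q : Cube n} {f : (Fin n → ℝ) → ℝ} (hf : IntegrableOn f Q.toSet) (a : ℝ) :
    |Q.avg f - a| ≤ Q.avg (fun x => |f x - a|) := by
  rw [← avg_sub_const hf]
  exact Q.abs_avg_le _

theorem osc_nonneg (Q : Cube n) (f : (Fin n → ℝ) → ℝ) : 0 ≤ Q.osc f :=
  Q.avg_nonneg fun _ => abs_nonneg _

theorem avgAbs_nonneg (Q : Cube n) (f : (Fin n → ℝ) → ℝ) : 0 ≤ Q.avgAbs f :=
  Q.avg_nonneg fun _ => abs_nonneg _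

/-- The mean oscillation is at most twice the mean deviation from any constant. -/
theorem osc_le_two_mul_avg {Q : Cube n} {f : (Fin n → ℝ) → ℝ} (hf : IntegrableOn f Q.toSet)
    (a : ℝ) : Q.osc f ≤ 2 * Q.avg (fun x => |f x - a|) := by
  have h : Q.osc f ≤ Q.avg (fun x => |f x - a| + |Q.avg f - a|) := by
    refine avg_mono (integrableOn_abs_sub_const hf _)
      ((integrableOn_abs_sub_const hf a).add (Q.integrableOn_const _)) fun x _ => ?_
    calc |f x - Q.avg f| = |(f x - a) - (Q.avg f - a)| := by ring_nf
      _ ≤ _ := abs_sub _ _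
  rw [avg_add (integrableOn_abs_sub_const hf a) (Q.integrableOn_const _), avg_const] at h
  linarith [abs_avg_sub_le hf a]

theorem osc_le_two_mul_avgAbs {Q : Cube n} {f : (Fin n → ℝ) → ℝ} (hf : IntegrableOn f Q.toSet) :
    Q.osc f ≤ 2 * Q.avgAbs f := by
  simpa [avgAbs, avg] using osc_le_two_mul_avg hf 0

theorem avg_abs_sub_le {Q : Cube n} {f : (Fin n → ℝ) → ℝ} (hf : IntegrableOn f Q.toSet)
    {a M : ℝ} (h : ∀ x ∈ Q.toSet, |f x - a| ≤ M) : Q.avg (fun x => |f x - a|) ≤ M := by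
  simpa [avg_const] using
    avg_mono (integrableOn_abs_sub_const hf a) (Q.integrableOn_const M) h

theorem osc_le_of_abs_sub_le {Q : Cube n} {f : (Fin n → ℝ) → ℝ} (hf : IntegrableOn f Q.toSet)
    {a M : ℝ} (h : ∀ x ∈ Q.toSet, |f x - a| ≤ M) : Q.osc f ≤ 2 * M := by
  linarith [osc_le_two_mul_avg hf a, avg_abs_sub_le hf h]

theorem avgAbs_le_of_abs_le {Q : Cube n} {f : (Fin n → ℝ) → ℝ} (hf : IntegrableOn f Q.toSet)
    {M : ℝ} (h : ∀ x ∈ Q.toSet, |f x| ≤ M) : Q.avgAbs f ≤ M := by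
  simpa [avgAbs, avg] using avg_abs_sub_le (a := 0) hf (M := M) (by simpa using h)

theorem avgAbs_add_le {Q : Cube n} {f g : (Fin n → ℝ) → ℝ} (hf : IntegrableOn f Q.toSet)
    (hg : IntegrableOn g Q.toSet) : Q.avgAbs (fun x => f x + g x) ≤ Q.avgAbs f + Q.avgAbs g := by
  refine (avg_mono (hf.add hg).abs (hf.abs.add hg.abs) fun x _ => abs_add_le _ _).trans ?_
  exact (avg_add hf.abs hg.abs).le

theorem osc_add_le {Q : Cube n} {f g : (Fin n → ℝ) → ℝ} (hf : IntegrableOn f Q.toSet)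
    (hg : IntegrableOn g Q.toSet) : Q.osc (fun x => f x + g x) ≤ Q.osc f + Q.osc g := by
  have h := avgAbs_add_le (hf.sub (Q.integrableOn_const (Q.avg f)))
    (hg.sub (Q.integrableOn_const (Q.avg g)))
  refine le_trans (le_of_eq ?_) h
  unfold osc avgAbs
  rw [avg_add hf hg]
  congr 1
  ext x
  simp only [Pi.sub_apply]
  ring_nf

theorem osc_sub_le {Q : Cube n} {f g : (Fin n → ℝ) → ℝ} (hf : IntegrableOn f Q.toSet)
    (hg : IntegrableOn g Q.toSet) : Q.osc (fun x => f x - g x) ≤ Q.osc f + Q.osc g := by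
  have h : Q.osc (fun x => -g x) = Q.osc g := by
    have hn : Q.avg (fun x => -g x) = -Q.avg g := by
      rw [avg_eq, avg_eq, integral_neg, mul_neg]
    unfold osc
    rw [hn]
    congr 1
    ext x
    rw [← abs_neg]
    ring_nf
  have h' := osc_add_le hf hg.neg
  simp only [Pi.neg_def, h] at h'
  simpa only [sub_eq_add_neg] using h'

theorem avg_le_of_subset {P Q : Cube n} (hPQ : P.toSet ⊆ Q.toSet) {f : (Fin n → ℝ) → ℝ}
    (hf : IntegrableOn f Q.toSet) (h0 : ∀ x, 0 ≤ f x) :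
    P.avg f ≤ (Q.half / P.half) ^ n * Q.avg f := by
  have hP := P.half_pos
  have hQ := Q.half_pos
  have h : ∫ x in P.toSet, f x ≤ ∫ x in Q.toSet, f x :=
    setIntegral_mono_set hf (Eventually.of_forall h0) (Eventually.of_forall hPQ)
  calc P.avg f = (P.side ^ n)⁻¹ * ∫ x in P.toSet, f x := avg_eq _ _
    _ ≤ (P.side ^ n)⁻¹ * ∫ x in Q.toSet, f x :=
      mul_le_mul_of_nonneg_left h (by have := P.side_pos; positivity)
    _ = _ := by
      rw [integral_eq_side_pow_mul_avg, side, side, mul_pow, mul_pow, div_pow]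
      field_simp

/-- A bound for the means of a nonnegative function over all cubes of half-side in `(r / 2, r]`
propagates to all larger cubes, by successive bisection. -/
theorem avgAbs_le_of_forall_half_le {f : (Fin n → ℝ) → ℝ}
    (hf : ∀ Q : Cube n, IntegrableOn f Q.toSet) {r C : ℝ}
    (h : ∀ Q : Cube n, r / 2 < Q.half → Q.half ≤ r → Q.avgAbs f ≤ C)
    (Q : Cube n) (hQ : r / 2 < Q.half) (hr : 0 < r) : Q.avgAbs f ≤ C := by
  have key : ∀ k : ℕ, ∀ Q : Cube n, r / 2 < Q.half → Q.half ≤ 2 ^ k * r → Q.avgAbs f ≤ C := by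
    intro k
    induction k with
    | zero => simpa using h
    | succ k ih =>
      intro Q hQ hQk
      rcases le_or_gt Q.half (2 ^ k * r) with hle | hlt
      · exact ih Q hQ hle
      have hk : (1 : ℝ) ≤ 2 ^ k := one_le_pow₀ (by norm_num)
      have hQ0 := Q.half_pos
      let P : (Fin n → Bool) → Cube n := fun σ =>
        ⟨fun i => Q.center i + (if σ i then Q.half / 2 else -(Q.half / 2)), Q.half / 2, _root_.half_pos hQ0⟩
      have hcover : Q.toSet ⊆ ⋃ σ, (P σ).toSet := by
        intro x hx
        rw [Set.mem_iUnion]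
        refine ⟨fun i => decide (Q.center i ≤ x i), ?_⟩
        have hx' := (dist_pi_le_iff hQ0.le).1 (mem_closedBall.1 hx)
        refine mem_closedBall.2 ((dist_pi_le_iff (_root_.half_pos hQ0).le).2 fun i => ?_)
        have hi := abs_le.1 (Real.dist_eq _ _ ▸ hx' i)
        rw [Real.dist_eq, abs_le]
        by_cases hc : Q.center i ≤ x i
        · simp only [P, hc, decide_true, if_true]
          constructor <;> linarith
        · simp only [P, hc, decide_false]
          push Not at hc
          constructor <;> simp <;> linarith
      have hP : ∀ σ, ∫ x in (P σ).toSet, |f x| ≤ Q.half ^ n * C := by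
        intro σ
        have h1 : (P σ).avgAbs f ≤ C :=
          ih (P σ) (by change r / 2 < Q.half / 2; nlinarith)
            (by change Q.half / 2 ≤ _; rw [pow_succ] at hQk; linarith)
        have h2 := (P σ).integral_eq_side_pow_mul_avg (fun x => |f x|)
        rw [h2, show (P σ).side = Q.half from by simp only [side, P]; ring]
        exact mul_le_mul_of_nonneg_left h1 (by positivity)
      have hint : ∫ x in Q.toSet, |f x| ≤ 2 ^ n * (Q.half ^ n * C) := by
        calc ∫ x in Q.toSet, |f x| ≤ ∫ x in ⋃ σ, (P σ).toSet, |f x| :=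
              setIntegral_mono_set (integrableOn_finite_iUnion.2 fun σ => (hf (P σ)).abs)
                (Eventually.of_forall fun _ => abs_nonneg _) (Eventually.of_forall hcover)
          _ ≤ ∑ σ, ∫ x in (P σ).toSet, |f x| := by
              rw [← integral_finsetSum_measure fun σ _ => (hf (P σ)).abs]
              refine integral_mono_measure ?_ (Eventually.of_forall fun _ => abs_nonneg _)
                (integrable_finsetSum_measure.2 fun σ _ => (hf (P σ)).abs)
              rw [← Measure.sum_fintype]
              exact Measure.restrict_iUnion_le
          _ ≤ ∑ _σ : Fin n → Bool, Q.half ^ n * C := Finset.sum_le_sum fun σ _ => hP σ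
          _ = 2 ^ n * (Q.half ^ n * C) := by simp
      change Q.avg (fun x => |f x|) ≤ C
      rw [avg_eq, inv_mul_le_iff₀ (by have := Q.side_pos; positivity), side, mul_pow]
      linarith
  obtain ⟨k, hk⟩ := pow_unbounded_of_one_lt (Q.half / r) (one_lt_two (α := ℝ))
  exact key k Q hQ ((div_le_iff₀ hr).1 hk.le)

end Cube

/-- The mean of `f` over the closed ball of radius `r` about a moving centre. -/
def ballMean (r : ℝ) (f : (Fin n → ℝ) → ℝ) (x : Fin n → ℝ) : ℝ := ⨍ y in closedBall x r, f y

theorem ballMean_eq_avg {r : ℝ} (hr : 0 < r) (f : (Fin n → ℝ) → ℝ) (x : Fin n → ℝ) :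
    ballMean r f x = (Cube.mk x r hr).avg f := rfl

theorem continuous_ballMean {r : ℝ} (hr : 0 < r) {f : (Fin n → ℝ) → ℝ}
    (hf : ∀ Q : Cube n, IntegrableOn f Q.toSet) : Continuous (ballMean r f) := by
  have h : ballMean r f = fun x => ((2 * r) ^ n)⁻¹ * ∫ y, (closedBall x r).indicator f y := by
    ext x
    rw [ballMean_eq_avg hr, Cube.avg_eq, integral_indicator measurableSet_closedBall]
    rfl
  rw [h]
  refine continuous_const.mul (continuous_iff_continuousAt.2 fun x₀ => ?_)
  have hbig : IntegrableOn f (closedBall x₀ (r + 1)) := hf ⟨x₀, r + 1, by linarith⟩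
  refine continuousAt_of_dominated (bound := (closedBall x₀ (r + 1)).indicator fun y => |f y|)
    (Eventually.of_forall fun x => ?_) ?_ ?_ ?_
  · exact ((integrable_indicator_iff measurableSet_closedBall).2
      (hf ⟨x, r, hr⟩)).aestronglyMeasurable
  · filter_upwards [ball_mem_nhds x₀ one_pos] with x hx
    refine Eventually.of_forall fun y => ?_
    by_cases hy : y ∈ closedBall x r
    · have hy' : y ∈ closedBall x₀ (r + 1) := by
        rw [mem_closedBall] at hy ⊢
        rw [mem_ball] at hx
        linarith [dist_triangle y x x₀]
      simp [hy, hy']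
    · rw [Set.indicator_of_notMem hy, norm_zero]
      exact Set.indicator_nonneg (fun _ _ => abs_nonneg _) _
  · exact (integrable_indicator_iff measurableSet_closedBall).2 hbig.abs
  · have hs : ∀ᵐ y ∂(volume : Measure (Fin n → ℝ)), y ∉ sphere x₀ r :=
      measure_eq_zero_iff_ae_notMem.1 (Measure.addHaar_sphere_of_ne_zero _ _ hr.ne')
    filter_upwards [hs] with y hy
    rw [mem_sphere] at hy
    have hc : ContinuousAt (fun x => dist y x) x₀ := by fun_prop
    rcases lt_or_gt_of_ne hy with hlt | hgt
    · refine (continuousAt_const (y := f y)).congr ?_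
      filter_upwards [hc.eventually_lt_const hlt] with x hx
      rw [Set.indicator_of_mem (mem_closedBall.2 hx.le)]
    · refine (continuousAt_const (y := (0 : ℝ))).congr ?_
      filter_upwards [hc.eventually_const_lt hgt] with x hx
      rw [Set.indicator_of_notMem (by rw [mem_closedBall]; exact not_le.2 hx)]

theorem abs_ballMean_sub_avg_le {r η : ℝ} (hr : 0 < r) {f : (Fin n → ℝ) → ℝ}
    {Q : Cube n} (hf : IntegrableOn f Q.toSet) (hQ : Q.half = 2 * r) (hosc : Q.osc f ≤ η)
    {x : Fin n → ℝ} (hx : dist x Q.center ≤ r) :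
    |ballMean r f x - Q.avg f| ≤ 2 ^ n * η := by
  have hsub : (Cube.mk x r hr).toSet ⊆ Q.toSet := by
    refine closedBall_subset_closedBall' ?_
    rw [hQ]
    change r + dist x Q.center ≤ 2 * r
    linarith
  rw [ballMean_eq_avg hr]
  refine (Cube.abs_avg_sub_le (hf.mono_set hsub) _).trans ?_
  refine (Cube.avg_le_of_subset hsub (Cube.integrableOn_abs_sub_const hf _)
    fun _ => abs_nonneg _).trans ?_
  have h2 : Q.half / (Cube.mk x r hr).half = 2 := by
    rw [hQ]
    field_simp
  rw [h2]
  exact mul_le_mul_of_nonneg_left hosc (by positivity)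

theorem osc_sub_ballMean_le {r η : ℝ} (hr : 0 < r) {f : (Fin n → ℝ) → ℝ}
    (hf : ∀ Q : Cube n, IntegrableOn f Q.toSet)
    (hosc : ∀ Q : Cube n, Q.half ≤ 2 * r → Q.osc f ≤ η) (P : Cube n) (hP : P.half ≤ r) :
    P.osc (fun x => f x - ballMean r f x) ≤ (1 + 2 * 2 ^ n) * η := by
  have hi := (continuous_ballMean hr hf).locallyIntegrable.integrableOn_isCompact
    (μ := volume) (isCompact_closedBall P.center P.half)
  have h1 := hosc P (by linarith)
  have h2 : P.osc (ballMean r f) ≤ 2 * (2 ^ n * η) := by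
    refine Cube.osc_le_of_abs_sub_le hi (a := (Cube.mk P.center (2 * r) (by linarith)).avg f)
      fun x hx => ?_
    exact abs_ballMean_sub_avg_le hr (hf _) rfl (hosc _ le_rfl) ((mem_closedBall.1 hx).trans hP)
  have h3 := Cube.osc_sub_le (hf P) hi
  linarith

theorem avgAbs_sub_ballMean_le {r η : ℝ} (hr : 0 < r) {f : (Fin n → ℝ) → ℝ}
    (hf : ∀ Q : Cube n, IntegrableOn f Q.toSet)
    (hosc : ∀ Q : Cube n, Q.half ≤ 2 * r → Q.osc f ≤ η) (P : Cube n) (hP : r / 2 < P.half) :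
    P.avgAbs (fun x => f x - ballMean r f x) ≤ (4 ^ n + 2 ^ n) * η := by
  have hi : ∀ Q : Cube n, IntegrableOn (ballMean r f) Q.toSet := fun Q =>
    (continuous_ballMean hr hf).locallyIntegrable.integrableOn_isCompact
      (μ := volume) (isCompact_closedBall Q.center Q.half)
  refine Cube.avgAbs_le_of_forall_half_le (fun Q => (hf Q).sub (hi Q)) (r := r)
    (fun P hP hPr => ?_) P hP hr
  let Q : Cube n := ⟨P.center, 2 * r, by linarith⟩
  have hPQ : P.toSet ⊆ Q.toSet := closedBall_subset_closedBall (by linarith)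
  have hη : 0 ≤ η := (Q.osc_nonneg f).trans (hosc Q le_rfl)
  have hfQ := Cube.integrableOn_abs_sub_const (hf P) (Q.avg f)
  have h1 : P.avgAbs (fun x => f x - ballMean r f x) ≤
      P.avg (fun x => |f x - Q.avg f| + 2 ^ n * η) := by
    refine Cube.avg_mono ((hf P).sub (hi P)).abs (hfQ.add (P.integrableOn_const _))
      fun x hx => ?_
    have h2 := abs_ballMean_sub_avg_le hr (hf Q) rfl (hosc Q le_rfl)
      ((mem_closedBall.1 hx).trans hPr)
    have h3 := abs_sub (f x - Q.avg f) (ballMean r f x - Q.avg f)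
    rw [sub_sub_sub_cancel_right] at h3
    linarith
  rw [Cube.avg_add hfQ (P.integrableOn_const _), Cube.avg_const] at h1
  have h4 : P.avg (fun x => |f x - Q.avg f|) ≤ 4 ^ n * η := by
    refine (Cube.avg_le_of_subset hPQ (Cube.integrableOn_abs_sub_const (hf Q) _)
      fun _ => abs_nonneg _).trans ?_
    have h5 : Q.half / P.half ≤ 4 := by
      rw [div_le_iff₀ P.half_pos]
      change 2 * r ≤ 4 * P.half
      linarith
    have h6 : 0 ≤ Q.half / P.half := div_nonneg Q.half_pos.le P.half_pos.le
    exact mul_le_mul (pow_le_pow_left₀ h6 h5 n) (hosc Q le_rfl) (Q.osc_nonneg f) (by positivity)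
  change P.avgAbs (fun x => f x - ballMean r f x) ≤ _
  linarith

theorem tendsto_ballMean_cocompact {r : ℝ} (hr : 0 < r) (hr' : r ≤ 1 / 2) {f : (Fin n → ℝ) → ℝ}
    (hf : ∀ Q : Cube n, IntegrableOn f Q.toSet)
    (hlim : Tendsto (fun x : Fin n → ℝ =>
        (Cube.mk (fun i => x i + 1/2) (1/2) (by norm_num)).avgAbs f)
      (cocompact (Fin n → ℝ)) (𝓝 0)) :
    Tendsto (ballMean r f) (cocompact (Fin n → ℝ)) (𝓝 0) := by
  have hshift : Tendsto (fun x : Fin n → ℝ => x + fun _ => -(1/2 : ℝ))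
      (cocompact _) (cocompact _) :=
    (Homeomorph.addRight (fun _ : Fin n => -(1/2 : ℝ))).isClosedEmbedding.tendsto_cocompact
  have h := (hlim.comp hshift).const_mul (((1/2) / r) ^ n)
  rw [mul_zero] at h
  refine squeeze_zero_norm (fun x => ?_) h
  let Q : Cube n := ⟨x, 1/2, by norm_num⟩
  have hQ : (Cube.mk (fun i => (x + fun _ => -(1/2 : ℝ) : Fin n → ℝ) i + 1/2) (1/2) (by norm_num) : Cube n)
      = Q := by
    simp [Q]
  rw [Function.comp_apply, hQ, Real.norm_eq_abs, ballMean_eq_avg hr]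
  refine (Cube.abs_avg_le _ _).trans ?_
  exact Cube.avg_le_of_subset (P := ⟨x, r, hr⟩) (Q := Q) (closedBall_subset_closedBall hr')
    (hf Q).abs fun _ => abs_nonneg _

/-- A continuous function vanishing at infinity is a uniform limit of continuous functions with
compact support. -/
theorem exists_hasCompactSupport_abs_sub_le {X : Type*} [TopologicalSpace X] [R1Space X]
    {h : X → ℝ} (hc : Continuous h) (h0 : Tendsto h (cocompact X) (𝓝 0)) {ε : ℝ} (hε : 0 < ε) :
    ∃ g : X → ℝ, Continuous g ∧ HasCompactSupport g ∧ ∀ x, |h x - g x| ≤ ε := by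
  refine ⟨fun x => h x - max (-ε) (min (h x) ε), by fun_prop, ?_, fun x => ?_⟩
  · obtain ⟨K, hK, hKs⟩ := mem_cocompact.1 (h0 (ball_mem_nhds 0 hε))
    refine HasCompactSupport.intro hK fun x hx => ?_
    have hx' : |h x| < ε := by simpa using hKs hx
    rw [abs_lt] at hx'
    rw [min_eq_left hx'.2.le, max_eq_right hx'.1.le, sub_self]
  · rw [sub_sub_cancel, abs_le]
    exact ⟨le_max_left _ _, max_le (by linarith) (min_le_right _ _)⟩

theorem omegaOn_nonneg (U : Set (Fin n → ℝ)) (f : (Fin n → ℝ) → ℝ) (t : ℝ) :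
    0 ≤ omegaOn U f t := by
  refine Real.sSup_nonneg ?_
  rintro _ ⟨Q, -, -, rfl⟩
  exact Q.osc_nonneg f

theorem bigAvgSup_nonneg (U : Set (Fin n → ℝ)) (lam : ℝ) (f : (Fin n → ℝ) → ℝ) :
    0 ≤ bigAvgSup U lam f := by
  refine Real.sSup_nonneg ?_
  rintro _ ⟨Q, -, -, rfl⟩
  exact Q.avgAbs_nonneg f

theorem bmoNorm_nonneg (U : Set (Fin n → ℝ)) (lam : ℝ) (f : (Fin n → ℝ) → ℝ) :
    0 ≤ bmoNorm U lam f :=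
  add_nonneg (omegaOn_nonneg _ _ _) (bigAvgSup_nonneg _ _ _)

theorem bmoNorm_le {U : Set (Fin n → ℝ)} {lam : ℝ} {f : (Fin n → ℝ) → ℝ} {A B : ℝ}
    (hA : ∀ Q : Cube n, Q.side < lam → Q.osc f ≤ A) (hA0 : 0 ≤ A)
    (hB : ∀ Q : Cube n, lam ≤ Q.side → Q.avgAbs f ≤ B) (hB0 : 0 ≤ B) :
    bmoNorm U lam f ≤ A + B := by
  refine add_le_add (Real.sSup_le ?_ hA0) (Real.sSup_le ?_ hB0)
  · rintro _ ⟨Q, -, h, rfl⟩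
    exact hA Q h
  · rintro _ ⟨Q, -, h, rfl⟩
    exact hB Q h

namespace MemBmo

variable {lam : ℝ} {f : (Fin n → ℝ) → ℝ}

theorem avgAbs_le_bmoNorm (hf : MemBmo Set.univ lam f) {Q : Cube n} (hQ : lam ≤ Q.side) :
    Q.avgAbs f ≤ bmoNorm Set.univ lam f :=
  (le_csSup hf.2.2 ⟨Q, Set.subset_univ _, hQ, rfl⟩).trans
    (le_add_of_nonneg_left (omegaOn_nonneg _ _ _))

theorem osc_le_bmoNorm (hf : MemBmo Set.univ lam f) {Q : Cube n} (hQ : Q.side < lam) :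
    Q.osc f ≤ bmoNorm Set.univ lam f :=
  (le_csSup hf.2.1 ⟨Q, Set.subset_univ _, hQ, rfl⟩).trans
    (le_add_of_nonneg_right (bigAvgSup_nonneg _ _ _))

theorem osc_le_two_mul_bmoNorm (hf : MemBmo Set.univ lam f) (Q : Cube n) :
    Q.osc f ≤ 2 * bmoNorm Set.univ lam f := by
  rcases lt_or_ge Q.side lam with h | h
  · linarith [hf.osc_le_bmoNorm h, bmoNorm_nonneg (Set.univ : Set (Fin n → ℝ)) lam f]
  · linarith [hf.avgAbs_le_bmoNorm h,
      Cube.osc_le_two_mul_avgAbs (hf.1 Q (Set.subset_univ _))]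

/-- Subtracting a bounded continuous function does not affect membership in bmo. -/
theorem sub_of_bounded (hf : MemBmo Set.univ lam f) {g : (Fin n → ℝ) → ℝ} (hg : Continuous g)
    {M : ℝ} (hM : ∀ x, |g x| ≤ M) : MemBmo Set.univ lam (f - g) := by
  have hi : ∀ Q : Cube n, IntegrableOn g Q.toSet := fun Q =>
    hg.locallyIntegrable.integrableOn_isCompact (isCompact_closedBall _ _)
  have hfi := fun Q : Cube n => hf.1 Q (Set.subset_univ _)
  refine ⟨fun Q _ => (hfi Q).sub (hi Q), ⟨2 * bmoNorm Set.univ lam f + 2 * M, ?_⟩,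
    ⟨bmoNorm Set.univ lam f + M, ?_⟩⟩
  · rintro _ ⟨Q, -, -, rfl⟩
    exact (Cube.osc_sub_le (hfi Q) (hi Q)).trans (add_le_add (hf.osc_le_two_mul_bmoNorm Q)
      (Cube.osc_le_of_abs_sub_le (hi Q) (a := 0) (by simpa using fun x _ => hM x)))
  · rintro _ ⟨Q, -, hQ, rfl⟩
    have h := Cube.avgAbs_add_le (hfi Q) (hi Q).neg
    refine le_trans (le_of_eq ?_) (h.trans (add_le_add (hf.avgAbs_le_bmoNorm hQ)
      (Cube.avgAbs_le_of_abs_le (hi Q).neg (by simpa using fun x _ => hM x))))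
    congr 1

end MemBmo

/-- A function of bmo with vanishing mean oscillation whose means over unit cubes vanish at
infinity is approximable in bmo by continuous functions with compact support. -/
theorem exists_bmoNorm_sub_le {f : (Fin n → ℝ) → ℝ} (hf : MemBmo Set.univ 1 f)
    (hosc : VanishSmallOsc Set.univ f)
    (hlim : Tendsto (fun x : Fin n → ℝ =>
        (Cube.mk (fun i => x i + 1/2) (1/2) (by norm_num)).avgAbs f)
      (cocompact (Fin n → ℝ)) (𝓝 0)) {η : ℝ} (hη : 0 < η) :
    ∃ g : (Fin n → ℝ) → ℝ, Continuous g ∧ HasCompactSupport g ∧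
      bmoNorm Set.univ 1 (f - g) ≤ (3 * (4 ^ n + 2 ^ n) + 3) * η := by
  have hfi := fun Q : Cube n => hf.1 Q (Set.subset_univ _)
  obtain ⟨δ, ⟨hδη, hδ1⟩, hδ0⟩ := ((hosc.eventually_lt_const hη).and
    (nhdsWithin_le_nhds (eventually_lt_nhds one_pos))).and
      (self_mem_nhdsWithin (s := Set.Ioi (0 : ℝ))) |>.exists
  have hr : 0 < δ / 8 := by linarith
  have hsmall : ∀ Q : Cube n, Q.half ≤ 2 * (δ / 8) → Q.osc f ≤ η := by
    intro Q hQ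
    have hQδ : Q.side < δ := by
      rw [Cube.side]
      linarith
    have hbdd : BddAbove {r | ∃ P : Cube n, P.toSet ⊆ Set.univ ∧ P.side < δ ∧ r = P.osc f} := by
      refine hf.2.1.mono ?_
      rintro _ ⟨P, hP, hPδ, rfl⟩
      exact ⟨P, hP, hPδ.trans hδ1, rfl⟩
    exact (le_csSup hbdd ⟨Q, Set.subset_univ _, hQδ, rfl⟩).trans hδη.le
  have hc := continuous_ballMean hr hfi
  obtain ⟨g, hg, hgs, hgb⟩ := exists_hasCompactSupport_abs_sub_le hc
    (tendsto_ballMean_cocompact hr (by linarith) hfi hlim) hη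
  refine ⟨g, hg, hgs, ?_⟩
  have hi : ∀ {h : (Fin n → ℝ) → ℝ}, Continuous h → ∀ Q : Cube n, IntegrableOn h Q.toSet :=
    fun hh Q => hh.locallyIntegrable.integrableOn_isCompact (isCompact_closedBall _ _)
  have hsplit : f - g = fun x =>
      (f x - ballMean (δ / 8) f x) + (ballMean (δ / 8) f x - g x) := by
    ext x
    simp
  have h2 : (1 : ℝ) ≤ 4 ^ n := one_le_pow₀ (by norm_num)
  have h3 : (0 : ℝ) < 2 ^ n := by positivity
  have hbound : bmoNorm Set.univ 1 (f - g) ≤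
      (2 * ((4 ^ n + 2 ^ n) * η) + 2 * η) + ((4 ^ n + 2 ^ n) * η + η) := by
    rw [hsplit]
    refine bmoNorm_le (fun Q _ => ?_) (by positivity) (fun Q hQ => ?_) (by positivity)
    · refine (Cube.osc_add_le ((hfi Q).sub (hi hc Q)) ((hi hc Q).sub (hi hg Q))).trans
        (add_le_add ?_ ?_)
      · rcases le_or_gt Q.half (δ / 8) with hQ | hQ
        · refine (osc_sub_ballMean_le hr hfi hsmall Q hQ).trans ?_
          nlinarith
        · refine (Cube.osc_le_two_mul_avgAbs ((hfi Q).sub (hi hc Q))).trans ?_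
          exact mul_le_mul_of_nonneg_left
            (avgAbs_sub_ballMean_le hr hfi hsmall Q (by linarith)) zero_le_two
      · exact Cube.osc_le_of_abs_sub_le ((hi hc Q).sub (hi hg Q)) (a := 0)
          (by simpa using fun x _ => hgb x)
    · refine (Cube.avgAbs_add_le ((hfi Q).sub (hi hc Q)) ((hi hc Q).sub (hi hg Q))).trans
        (add_le_add ?_ ?_)
      · rw [Cube.side] at hQ
        exact avgAbs_sub_ballMean_le hr hfi hsmall Q (by linarith)
      · exact Cube.avgAbs_le_of_abs_le ((hi hc Q).sub (hi hg Q)) fun x _ => hgb x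
  linarith

theorem inCmoClosure_of_vanishSmallOsc {f : (Fin n → ℝ) → ℝ} (hf : MemBmo Set.univ 1 f)
    (hosc : VanishSmallOsc Set.univ f)
    (hlim : Tendsto (fun x : Fin n → ℝ =>
        (Cube.mk (fun i => x i + 1/2) (1/2) (by norm_num)).avgAbs f)
      (cocompact (Fin n → ℝ)) (𝓝 0)) : InCmoClosure Set.univ 1 f := by
  choose g hg hgs hgb using fun j : ℕ =>
    exists_bmoNorm_sub_le hf hosc hlim (η := 1 / ((j : ℝ) + 1)) (by positivity)
  refine ⟨g, fun j => ⟨hg j, hgs j, Set.subset_univ _⟩, ?_⟩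
  have h := (tendsto_one_div_add_atTop_nhds_zero_nat (𝕜 := ℝ)).const_mul
    (3 * (4 ^ n + 2 ^ n) + 3 : ℝ)
  rw [mul_zero] at h
  exact squeeze_zero (fun j => bmoNorm_nonneg _ _ _) hgb h

namespace InCmoClosure

variable {f : (Fin n → ℝ) → ℝ}

theorem exists_decomposition (hcmo : InCmoClosure Set.univ 1 f) (hf : MemBmo Set.univ 1 f)
    {ε : ℝ} (hε : 0 < ε) :
    ∃ g : (Fin n → ℝ) → ℝ, Continuous g ∧ HasCompactSupport g ∧
      (∀ Q : Cube n, Q.osc f ≤ 2 * ε + Q.osc g) ∧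
      ∀ Q : Cube n, 1 ≤ Q.side → Q.avgAbs f ≤ ε + Q.avgAbs g := by
  obtain ⟨g, hg, hlim⟩ := hcmo
  obtain ⟨j, hj⟩ := (hlim.eventually_lt_const hε).exists
  obtain ⟨hc, hs, -⟩ := hg j
  obtain ⟨M, hM⟩ := hc.bounded_above_of_compact_support hs
  have hmem := hf.sub_of_bounded hc hM
  have hi : ∀ Q : Cube n, IntegrableOn (g j) Q.toSet := fun Q =>
    hc.locallyIntegrable.integrableOn_isCompact (isCompact_closedBall _ _)
  have hfg : (fun x => (f - g j) x + g j x) = f := by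
    ext x
    simp
  refine ⟨g j, hc, hs, fun Q => ?_, fun Q hQ => ?_⟩
  · have h := Cube.osc_add_le (hmem.1 Q (Set.subset_univ _)) (hi Q)
    rw [hfg] at h
    linarith [hmem.osc_le_two_mul_bmoNorm Q]
  · have h := Cube.avgAbs_add_le (hmem.1 Q (Set.subset_univ _)) (hi Q)
    rw [hfg] at h
    linarith [hmem.avgAbs_le_bmoNorm hQ]

theorem vanishSmallOsc (hcmo : InCmoClosure Set.univ 1 f) (hf : MemBmo Set.univ 1 f) :
    VanishSmallOsc Set.univ f := by
  refine Metric.tendsto_nhds.2 fun ε hε => ?_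
  obtain ⟨g, hc, hs, hosc, -⟩ := hcmo.exists_decomposition hf (ε := ε / 8) (by positivity)
  obtain ⟨δ, hδ, hu⟩ := Metric.uniformContinuous_iff.1
    (hc.uniformContinuous_of_tendsto_cocompact
      hs.is_zero_at_infty) (ε / 8) (by positivity)
  filter_upwards [nhdsWithin_le_nhds (eventually_lt_nhds hδ)] with t ht
  rw [Real.dist_0_eq_abs, abs_of_nonneg (omegaOn_nonneg _ _ _)]
  refine lt_of_le_of_lt (Real.sSup_le (a := ε / 2) ?_ (by positivity)) (by linarith)
  rintro _ ⟨Q, -, hQ, rfl⟩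
  have hQ0 := Q.half_pos
  rw [Cube.side] at hQ
  have h : Q.osc g ≤ 2 * (ε / 8) := by
    refine Cube.osc_le_of_abs_sub_le (hc.locallyIntegrable.integrableOn_isCompact
      (isCompact_closedBall _ _)) (a := g Q.center) fun x hx => ?_
    exact (hu (lt_of_le_of_lt (mem_closedBall.1 hx) (by linarith))).le
  linarith [hosc Q]

theorem eventually_eq_zero_near {g : (Fin n → ℝ) → ℝ} (hs : HasCompactSupport g) (R : ℝ) :
    ∀ᶠ x in cocompact (Fin n → ℝ), ∀ y, dist y x ≤ R → g y = 0 := by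
  obtain ⟨S, hS⟩ := hs.isCompact.isBounded.subset_closedBall 0
  filter_upwards [(tendsto_norm_cocompact_atTop (E := Fin n → ℝ)).eventually_gt_atTop (S + R)]
    with x hx y hy
  by_contra hne
  have h1 : dist y 0 ≤ S := mem_closedBall.1 (hS (subset_tsupport _ hne))
  rw [← dist_zero_right] at hx
  linarith [dist_triangle x y 0, dist_comm x y]

theorem tendsto_sSup_osc (hcmo : InCmoClosure Set.univ 1 f) (hf : MemBmo Set.univ 1 f) :
    Tendsto (fun x : Fin n → ℝ =>
        sSup {r | ∃ Q : Cube n, Q.center = x ∧ Q.side ≤ 1 ∧ r = Q.osc f})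
      (cocompact (Fin n → ℝ)) (𝓝 0) := by
  refine Metric.tendsto_nhds.2 fun ε hε => ?_
  obtain ⟨g, hc, hs, hosc, -⟩ := hcmo.exists_decomposition hf (ε := ε / 8) (by positivity)
  filter_upwards [eventually_eq_zero_near hs 1] with x hx
  rw [Real.dist_0_eq_abs, abs_of_nonneg (Real.sSup_nonneg (by
    rintro _ ⟨Q, -, -, rfl⟩
    exact Q.osc_nonneg f))]
  refine lt_of_le_of_lt (Real.sSup_le (a := ε / 2) ?_ (by positivity)) (by linarith)
  rintro _ ⟨Q, rfl, hQ, rfl⟩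
  have hQ0 := Q.half_pos
  rw [Cube.side] at hQ
  have h : Q.osc g ≤ 2 * 0 := by
    refine Cube.osc_le_of_abs_sub_le (hc.locallyIntegrable.integrableOn_isCompact
      (isCompact_closedBall _ _)) (a := 0) fun y hy => ?_
    simp [hx y ((mem_closedBall.1 hy).trans (by linarith))]
  linarith [hosc Q]

theorem tendsto_avgAbs (hcmo : InCmoClosure Set.univ 1 f) (hf : MemBmo Set.univ 1 f) :
    Tendsto (fun x : Fin n → ℝ =>
        (Cube.mk (fun i => x i + 1/2) (1/2) (by norm_num)).avgAbs f)
      (cocompact (Fin n → ℝ)) (𝓝 0) := by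
  refine Metric.tendsto_nhds.2 fun ε hε => ?_
  obtain ⟨g, hc, hs, -, havg⟩ := hcmo.exists_decomposition hf (ε := ε / 2) (by positivity)
  filter_upwards [eventually_eq_zero_near hs 1] with x hx
  set Q : Cube n := ⟨fun i => x i + 1/2, 1/2, by norm_num⟩ with hQ
  rw [Real.dist_0_eq_abs, abs_of_nonneg (Q.avgAbs_nonneg f)]
  have h : Q.avgAbs g ≤ 0 := by
    refine Cube.avgAbs_le_of_abs_le (hc.locallyIntegrable.integrableOn_isCompact
      (isCompact_closedBall _ _)) fun y hy => ?_
    have hcx : dist Q.center x ≤ 1 / 2 := by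
      refine (dist_pi_le_iff (by norm_num)).2 fun i => ?_
      simp [hQ]
    have hyc : dist y Q.center ≤ 1 / 2 := mem_closedBall.1 hy
    simp [hx y (by linarith [dist_triangle y Q.center x])]
  linarith [havg Q (by simp [hQ, Cube.side])]

end InCmoClosure

/-- Characterization of cmo(ℝⁿ): f is in the bmo-closure of C_c(ℝⁿ) iff f has vanishing
mean oscillation, the oscillations over cubes of sidelength ≤ 1 centered at x vanish as
|x| → ∞, and the averages of |f| over the translated unit cubes Q₀ + x vanish as |x| → ∞. -/
theorem stmt6 {n : ℕ} (hn : 0 < n) (f : (Fin n → ℝ) → ℝ)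
    (hf : MemBmo (Set.univ : Set (Fin n → ℝ)) 1 f) :
    InCmoClosure (Set.univ : Set (Fin n → ℝ)) 1 f ↔
      (VanishSmallOsc (Set.univ : Set (Fin n → ℝ)) f ∧
        Tendsto (fun x : Fin n → ℝ =>
            sSup {r | ∃ Q : Cube n, Q.center = x ∧ Q.side ≤ 1 ∧ r = Q.osc f})
          (cocompact (Fin n → ℝ)) (nhds 0) ∧
        Tendsto (fun x : Fin n → ℝ =>
            (Cube.mk (fun i => x i + 1/2) (1/2) (by norm_num)).avgAbs f)
          (cocompact (Fin n → ℝ)) (nhds 0)) := by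
  refine ⟨fun h => ⟨h.vanishSmallOsc hf, h.tendsto_sSup_osc hf, h.tendsto_avgAbs hf⟩, ?_⟩
  rintro ⟨hosc, -, hlim⟩
  exact inCmoClosure_of_vanishSmallOsc hf hosc hlim
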